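/- Let R be a prime ring, I a nonzero (two-sided) ideal of R, and n ≥ 2 a fixed integer. Suppose F : R → R is a two-sided multiplicative (generalized)-derivation associated with a multiplicative derivation δ of R such that F acts as an n-antihomomorphism on I. Then either δ = 0, or [y^{n−1}, x] δ(y) = 0 for all x, y ∈ I. -/

import Mathlib

/-- In a prime ring, a nonzero two-sided ideal can be used to test vanishing of products. -/
theorem eq_zero_or_eq_zero_of_forall_mem_mul {R : Type*} [Ring R]
    (hprime : ∀ a b : R, (∀ r : R, a * r * b = 0) → a = 0 ∨ b = 0)
    (I : TwoSidedIdeal R) (hI : ∃ x : R, x ∈ I ∧ x ≠ 0) {p q : R}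
    (h : ∀ x ∈ I, p * x * q = 0) : p = 0 ∨ q = 0 := by
  obtain ⟨x, hx, hx0⟩ := hI
  refine or_iff_not_imp_left.2 fun hp => ?_
  refine (hprime x q fun s => ?_).resolve_left hx0
  refine (hprime p (x * s * q) fun r => ?_).resolve_left hp
  have := h (r * x * s) (I.mul_mem_right _ _ (I.mul_mem_left _ _ hx))
  simpa only [mul_assoc] using this

/-- If `p` and `q` are proportional to `δ ≠ 0` in the sense of
`δ t * r * p s = q t * r * δ s`, then they agree. -/
theorem eq_of_mul_mul_eq_mul_mul {R : Type*} [Ring R]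
    (hprime : ∀ a b : R, (∀ r : R, a * r * b = 0) → a = 0 ∨ b = 0)
    {δ p q : R → R} {t : R} (ht : δ t ≠ 0)
    (h : ∀ t r s : R, δ t * r * p s = q t * r * δ s) (s : R) : p s = q s := by
  refine sub_eq_zero.1 ((hprime _ _ fun r' => ?_).resolve_right ht)
  refine (hprime (δ t) _ fun r => ?_).resolve_left ht
  have h1 := h t r s
  have h2 := h t (r * δ s * r') t
  have h3 := h s r' t
  calc δ t * r * ((p s - q s) * r' * δ t)
      = (δ t * r * p s) * r' * δ t - δ t * r * (q s * r' * δ t) := by noncomm_ring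
    _ = q t * (r * δ s * r') * δ t - δ t * (r * δ s * r') * p t := by
        rw [h1, ← h3]; noncomm_ring
    _ = 0 := by rw [h2, sub_self]

/-- A two-sided generalized derivation `F` with associated map `δ ≠ 0` has no common right
annihilator for the products of `k` of its values on a nonzero ideal. -/
theorem eq_zero_of_forall_map_prod_mul {R : Type*} [Ring R]
    (hprime : ∀ a b : R, (∀ r : R, a * r * b = 0) → a = 0 ∨ b = 0)
    (I : TwoSidedIdeal R) (hI : ∃ x : R, x ∈ I ∧ x ≠ 0) {F δ : R → R}
    (hF' : ∀ x y : R, F (x * y) = δ x * y + x * F y) {t : R} (ht : δ t ≠ 0) (k : ℕ) :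
    ∀ A : R, (∀ l : List R, l.length = k → (∀ x ∈ l, x ∈ I) → (l.map F).prod * A = 0) →
      A = 0 := by
  induction k with
  | zero =>
    intro A h
    simpa using h [] rfl (by simp)
  | succ k ih =>
    intro A h
    refine ih A fun l hl hlI => ?_
    have hann : ∀ x ∈ I, F x * ((l.map F).prod * A) = 0 := fun x hx => by
      simpa [mul_assoc] using h (x :: l) (by simp [hl]) (by simpa using ⟨hx, hlI⟩)
    refine (eq_zero_or_eq_zero_of_forall_mem_mul hprime I hI fun x hx => ?_).resolve_left ht
    have := hann (t * x) (I.mul_mem_left _ _ hx)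
    rwa [hF', add_mul, mul_assoc t, hann x hx, mul_zero, add_zero] at this

/-- A two-sided generalized derivation with `δ ≠ 0` acting as an `n`-antihomomorphism on a
nonzero ideal satisfies a balanced two-variable relation on that ideal. -/
theorem mul_map_mul_eq_map_mul_mul {R : Type*} [Ring R]
    (hprime : ∀ a b : R, (∀ r : R, a * r * b = 0) → a = 0 ∨ b = 0)
    (I : TwoSidedIdeal R) (hI : ∃ x : R, x ∈ I ∧ x ≠ 0) {n : ℕ} (hn : 2 ≤ n) {F δ : R → R}
    (hF' : ∀ x y : R, F (x * y) = δ x * y + x * F y) {t : R} (ht : δ t ≠ 0)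
    (hnanti : ∀ l : List R, l.length = n → (∀ x ∈ l, x ∈ I) →
      F l.prod = (l.reverse.map F).prod)
    {a b : R} (ha : a ∈ I) (hb : b ∈ I) (r : R) : F b * F (a * r) = F (r * b) * F a := by
  refine sub_eq_zero.1 (eq_zero_of_forall_map_prod_mul hprime I hI hF' ht (n - 2) _
    fun l hl hlI => ?_)
  have hlen : l.length + 1 + 1 = n := by omega
  have h1 := hnanti (a * r :: b :: l.reverse) (by simpa using hlen)
    (by simpa using ⟨I.mul_mem_right _ _ ha, hb, hlI⟩)
  have h2 := hnanti (a :: r * b :: l.reverse) (by simpa using hlen)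
    (by simpa using ⟨ha, I.mul_mem_left _ _ hb, hlI⟩)
  have h3 : (a * r :: b :: l.reverse).prod = (a :: r * b :: l.reverse).prod := by
    simp [mul_assoc]
  rw [h3, h2] at h1
  simp only [List.reverse_cons, List.reverse_reverse, List.map_append, List.map_cons,
    List.map_nil, List.prod_append, List.prod_cons, List.prod_nil, mul_one, mul_assoc] at h1
  rw [mul_sub, sub_eq_zero]
  exact h1.symm

/-- If `P * r + A * δ r = δ r * B + r * P` for all `r`, with `δ ≠ 0` a multiplicative
derivation of a prime ring, then `A + B` is central. -/
theorem commute_add_of_mul_add_mul_eq {R : Type*} [Ring R]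
    (hprime : ∀ a b : R, (∀ r : R, a * r * b = 0) → a = 0 ∨ b = 0)
    {δ : R → R} (hδ : ∀ x y : R, δ (x * y) = δ x * y + x * δ y) {t : R} (ht : δ t ≠ 0)
    {P A B : R} (h : ∀ r : R, P * r + A * δ r = δ r * B + r * P) (s : R) :
    Commute (A + B) s := by
  have h2 : ∀ r s : R, δ r * (B * s - s * B) = (r * A - A * r) * δ s := fun r s => by
    have e := h (r * s)
    rw [hδ] at e
    have e1 : (P * r + A * δ r) * s = (δ r * B + r * P) * s := by rw [h r]
    have e2 : r * (P * s + A * δ s) = r * (δ s * B + s * P) := by rw [h s]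
    rw [← sub_eq_zero] at e e1 e2 ⊢
    have key : δ r * (B * s - s * B) - (r * A - A * r) * δ s =
        (P * (r * s) + A * (δ r * s + r * δ s) - ((δ r * s + r * δ s) * B + r * s * P))
        - ((P * r + A * δ r) * s - (δ r * B + r * P) * s)
        - (r * (P * s + A * δ s) - r * (δ s * B + s * P)) := by noncomm_ring
    rw [key, e, e1, e2]; simp
  have h3 : ∀ t r s : R, δ t * r * (B * s - s * B) = (t * A - A * t) * r * δ s :=
    fun t r s => by
      have e := h2 (t * r) s
      rw [hδ, add_mul, mul_assoc t, h2 r s] at e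
      rw [eq_sub_of_add_eq e]
      noncomm_ring
  have h4 := eq_of_mul_mul_eq_mul_mul hprime (p := fun s => B * s - s * B)
    (q := fun s => s * A - A * s) ht h3 s
  have h5 : (A + B) * s - s * (A + B) = (B * s - s * B) - (s * A - A * s) := by noncomm_ring
  exact sub_eq_zero.1 (h5.trans (sub_eq_zero.2 h4))


/-- Let `R` be a prime ring, `I` a nonzero two-sided ideal, `n ≥ 2`.  If `F` is a
two-sided multiplicative (generalized)-derivation associated with `δ` acting as an
`n`-antihomomorphism on `I`, then either `δ = 0` or `[y^(n-1), x] δ(y) = 0` for all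
`x, y ∈ I`. -/
theorem stmt_12 {R : Type*} [Ring R]
    (hprime : ∀ a b : R, (∀ r : R, a * r * b = 0) → a = 0 ∨ b = 0)
    (I : TwoSidedIdeal R) (hI : ∃ x : R, x ∈ I ∧ x ≠ 0)
    (n : ℕ) (hn : 2 ≤ n)
    (F δ : R → R)
    (hδ : ∀ x y : R, δ (x * y) = δ x * y + x * δ y)
    (hF : ∀ x y : R, F (x * y) = F x * y + x * δ y)
    (hF' : ∀ x y : R, F (x * y) = δ x * y + x * F y)
    (hnanti : ∀ l : List R, l.length = n → (∀ x ∈ l, x ∈ I) →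
      F l.prod = (l.reverse.map F).prod) :
    δ = 0 ∨ ∀ x ∈ I, ∀ y ∈ I,
      (y ^ (n - 1) * x - x * y ^ (n - 1)) * δ y = 0 := by
  refine or_iff_not_imp_left.2 fun hne x _ y _ => ?_
  obtain ⟨t, ht⟩ : ∃ t, δ t ≠ 0 := by
    by_contra! h
    exact hne (funext h)
  have hcentral : ∀ a ∈ I, ∀ b ∈ I, ∀ s : R, Commute (F b * a + b * F a) s := by
    intro a ha b hb
    refine commute_add_of_mul_add_mul_eq hprime hδ ht (P := F b * F a) fun r => ?_
    have h := mul_map_mul_eq_map_mul_mul hprime I hI hn hF' ht hnanti ha hb r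
    rw [hF, hF', mul_add, add_mul] at h
    simpa only [mul_assoc] using h
  have hcomm : ∀ a ∈ I, ∀ b ∈ I, Commute (b * a * δ y) y := by
    intro a ha b hb
    have h := hcentral (a * y) (I.mul_mem_right _ _ ha) b hb y
    have e : F b * (a * y) + b * F (a * y) = (F b * a + b * F a) * y + b * a * δ y := by
      rw [hF]; noncomm_ring
    rw [e] at h
    simpa using h.sub_left ((hcentral a ha b hb y).mul_left (Commute.refl y))
  rcases eq_or_ne (δ y) 0 with hy | hy
  · rw [hy, mul_zero]
  suffices hyx : Commute y x by rw [(hyx.pow_left (n - 1)).eq, sub_self, zero_mul]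
  obtain ⟨a, ha, hay⟩ : ∃ a ∈ I, a * δ y ≠ 0 := by
    by_contra! h
    obtain ⟨z, hz, hz0⟩ := hI
    exact (hprime z (δ y) fun r => h _ (I.mul_mem_right _ _ hz)).elim hz0 hy
  refine sub_eq_zero.1 ((eq_zero_or_eq_zero_of_forall_mem_mul hprime I hI
    fun b hb => ?_).resolve_right hay)
  have h1 := (hcomm a ha b hb).eq
  have h2 := (hcomm a ha (x * b) (I.mul_mem_left _ _ hb)).eq
  calc (y * x - x * y) * b * (a * δ y)
      = y * (x * b * a * δ y) - x * (y * (b * a * δ y)) := by noncomm_ring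
    _ = 0 := by rw [← h2, ← h1]; noncomm_ring
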